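/- arXiv:2201.11689 — 2 statements merged into one kernel-verified Lean document; each statement's English description precedes it below -/
import Mathlib

section
/- Let S = ℤ[a2001, a1200, a1110, a1101, a0210, M0, M1, N0, N1, p2, p3], w = a2001·a0210 + a1110·a1101, and let (q0, q1, q2, q3) = G(M0 + 2·N0, M1 + 2·N1, p2, p3) ∈ S⁴. Then q3 ≡ 4·w·a1200²·M0¹¹·M1⁷·(a2001·M0 + a1101·M1)·(a1110²·M0² + a0210²·M1²)·(a2001²·M0² + a1101²·M1²)·(a2001⁴·M0⁴ + a1101⁴·M1⁴) modulo the ideal of S generated by 8, 2·p2, 2·p3, p2², p2·p3 and p3². -/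
/- STATEMENT 8: identity (eq_q3_in_I) from the proof of Lemma 3.9 of the paper.
S = ℤ[a2001, a1200, a1110, a1101, a0210, M0, M1, N0, N1, p2, p3] is realized as
MvPolynomial (Fin 11) ℤ with the variables in that order (indices 0,…,10).
The cubic f, the Blanc involution tuples σ1, σ2, σ3 and the composite substitution
map G = σ1 ∘ σ2 ∘ σ3 are defined below over an arbitrary commutative ring of
coefficients a : Fin 5 → A. -/

open MvPolynomial

noncomputable section

variable {A : Type} [CommRing A]

/-- The cubic form f = a2001·x0²x3 + a1200·x0x1² + a1110·x0x1x2 + a1101·x0x1x3 + a0210·x1²x2,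
with coefficients a = (a2001, a1200, a1110, a1101, a0210) : Fin 5 → A. -/
def cub (a : Fin 5 → A) : MvPolynomial (Fin 4) A :=
  C (a 0) * X 0 ^ 2 * X 3 + C (a 1) * X 0 * X 1 ^ 2 + C (a 2) * X 0 * X 1 * X 2 +
    C (a 3) * X 0 * X 1 * X 3 + C (a 4) * X 1 ^ 2 * X 2

/-- The Blanc involution tuple σ1 = (x0·∂f/∂x1, x1·∂f/∂x1 − 2f, x2·∂f/∂x1, x3·∂f/∂x1). -/
def sig1 (a : Fin 5 → A) : Fin 4 → MvPolynomial (Fin 4) A :=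
  ![X 0 * pderiv 1 (cub a), X 1 * pderiv 1 (cub a) - 2 * cub a,
    X 2 * pderiv 1 (cub a), X 3 * pderiv 1 (cub a)]

/-- The Blanc involution tuple σ2. -/
def sig2 (a : Fin 5 → A) : Fin 4 → MvPolynomial (Fin 4) A :=
  ![X 0 * pderiv 2 (cub a), X 1 * pderiv 2 (cub a),
    X 2 * pderiv 2 (cub a) - 2 * cub a, X 3 * pderiv 2 (cub a)]

/-- The Blanc involution tuple σ3. -/
def sig3 (a : Fin 5 → A) : Fin 4 → MvPolynomial (Fin 4) A :=
  ![X 0 * pderiv 3 (cub a), X 1 * pderiv 3 (cub a),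
    X 2 * pderiv 3 (cub a), X 3 * pderiv 3 (cub a) - 2 * cub a]

/-- G(v) = σ1(σ2(σ3(v))): substitute v into σ3, the result into σ2, that into σ1. -/
def Gmap (a : Fin 5 → A) (v : Fin 4 → A) : Fin 4 → A :=
  fun i => eval (fun j => eval (fun k => eval v (sig3 a k)) (sig2 a j)) (sig1 a i)

abbrev S₈ : Type := MvPolynomial (Fin 11) ℤ

/-- Evaluation of the cubic. -/
def cubv {B : Type} [CommRing B] (a b c d e x y z t : B) : B :=
  a * x ^ 2 * t + b * x * y ^ 2 + c * x * y * z + d * x * y * t + e * y ^ 2 * z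

/-- The third component of the composite, with the intermediate points written as `y` and `z`. -/
lemma Gmap_three {B : Type} [CommRing B] (a b c d e u v p r : B)
    (y0 y1 y2 y3 z0 z1 z2 z3 : B)
    (hy0 : y0 = u * (a * u ^ 2 + d * u * v))
    (hy1 : y1 = v * (a * u ^ 2 + d * u * v))
    (hy2 : y2 = p * (a * u ^ 2 + d * u * v))
    (hy3 : y3 = r * (a * u ^ 2 + d * u * v) - 2 * cubv a b c d e u v p r)
    (hz0 : z0 = y0 * (c * y0 * y1 + e * y1 ^ 2))
    (hz1 : z1 = y1 * (c * y0 * y1 + e * y1 ^ 2))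
    (hz2 : z2 = y2 * (c * y0 * y1 + e * y1 ^ 2) - 2 * cubv a b c d e y0 y1 y2 y3)
    (hz3 : z3 = y3 * (c * y0 * y1 + e * y1 ^ 2)) :
    Gmap ![a, b, c, d, e] ![u, v, p, r] 3 =
      z3 * (2 * b * z0 * z1 + c * z0 * z2 + d * z0 * z3 + 2 * e * z1 * z2) := by
  have h3 : (fun k => eval ![u, v, p, r] (sig3 ![a, b, c, d, e] k)) = ![y0, y1, y2, y3] := by
    funext k
    fin_cases k <;> simp [sig3, cub, cubv, hy0, hy1, hy2, hy3, pderiv_X, Pi.single_apply] <;> ring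
  have h2 : (fun k => eval ![y0, y1, y2, y3] (sig2 ![a, b, c, d, e] k)) = ![z0, z1, z2, z3] := by
    clear h3 hy0 hy1 hy2 hy3
    funext k
    fin_cases k <;> simp [sig2, cub, cubv, hz0, hz1, hz2, hz3, pderiv_X, Pi.single_apply] <;> ring
  unfold Gmap
  rw [h3, h2]
  clear h2 h3 hy0 hy1 hy2 hy3 hz0 hz1 hz2 hz3
  simp [sig1, cub, pderiv_X, Pi.single_apply]
  ring

/-- The congruence, in an arbitrary ring where the generators of the ideal vanish. -/
lemma Gmap_three_cong {B : Type} [CommRing B] (a b c d e M N M' N' p r : B)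
    (h8 : (8 : B) = 0) (hp : 2 * p = 0) (hr : 2 * r = 0) (hpr : p * r = 0) (hrr : r ^ 2 = 0) :
    Gmap ![a, b, c, d, e] ![M + 2 * M', N + 2 * N', p, r] 3 =
      4 * (a * e + c * d) * b ^ 2 * M ^ 11 * N ^ 7 * (a * M + d * N) *
        (c ^ 2 * M ^ 2 + e ^ 2 * N ^ 2) * (a ^ 2 * M ^ 2 + d ^ 2 * N ^ 2) *
        (a ^ 4 * M ^ 4 + d ^ 4 * N ^ 4) := by
  obtain ⟨u, hu⟩ : ∃ u, u = M + 2 * M' := ⟨_, rfl⟩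
  obtain ⟨v, hv⟩ : ∃ v, v = N + 2 * N' := ⟨_, rfl⟩
  rw [← hu, ← hv]
  obtain ⟨L, hL⟩ : ∃ L, L = a * u + d * v := ⟨_, rfl⟩
  obtain ⟨K, hK⟩ : ∃ K, K = c * u + e * v := ⟨_, rfl⟩
  obtain ⟨s, hs⟩ : ∃ s, s = r * L - 2 * b * v ^ 2 := ⟨_, rfl⟩
  obtain ⟨t, ht⟩ : ∃ t, t = p * K + 2 * b * u * v := ⟨_, rfl⟩
  have key := Gmap_three a b c d e u v p r
    (u * (u * L)) (u * (v * L)) (u * (p * L)) (u * s)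
    (u ^ 3 * v * L ^ 2 * (u * L * K)) (u ^ 3 * v * L ^ 2 * (v * L * K))
    (u ^ 3 * v * L ^ 2 * (L * t)) (u ^ 3 * v * L ^ 2 * (s * K))
    (by rw [hL]; ring) (by rw [hL]; ring) (by rw [hL]; ring)
    (by
      rw [hs, hL, cubv]
      linear_combination (a * u ^ 2 + d * u * v) * hr + (c * u * v + e * v ^ 2) * hp)
    (by rw [hK]; ring) (by rw [hK]; ring)
    (by
      have hf : cubv a b c d e (u * (u * L)) (u * (v * L)) (u * (p * L)) (u * s) =
          u ^ 3 * L ^ 3 * (u * b * v ^ 2 + p * v * K) + u ^ 4 * L ^ 2 * s * (a * u + d * v) := by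
        rw [cubv, hK]; ring
      rw [hf, ← hL, ht, hs]
      have hk : c * (u * (u * L)) * (u * (v * L)) + e * (u * (v * L)) ^ 2
          = u ^ 2 * L ^ 2 * v * K := by rw [hK]; ring
      rw [hk]
      linear_combination u ^ 3 * L ^ 3 * v * K * hp + 2 * u ^ 4 * L ^ 4 * hr 
        - u ^ 4 * L ^ 4 * hr)
    (by rw [hK]; ring)
  rw [key]
  have e1 : s * (2 * b * u * v * L * K + c * u * L * t + d * u * s * K + 2 * e * v * L * t)
      = 4 * b ^ 2 * u ^ 2 * v ^ 4 * (a * e + c * d) := by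
    have hX : 2 * b * u * v * L * K + c * u * L * t + d * u * s * K + 2 * e * v * L * t
       = 2 * b * u * v * L * K + c * u * L * p * K + 2 * b * c * u ^ 2 * v * L + d * u * r * L * K
         - 2 * b * d * u * v ^ 2 * K + 4 * b * e * u * v ^ 2 * L := by
      rw [ht, hs]
      linear_combination e * v * L * K * hp
    have hX2 : s * (2 * b * u * v * L * K + c * u * L * t + d * u * s * K + 2 * e * v * L * t)
       = 4 * b ^ 2 * u * v ^ 3 * (L * K + c * u * L + d * v * K) := by
      rw [hX, hs]
      linear_combination (L * (b * u * v * L * K + b * c * u ^ 2 * v * L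
         - b * d * u * v ^ 2 * K + 2 * b * e * u * v ^ 2 * L)
         - b * v ^ 2 * d * u * L * K) * hr + L * c * u * L * K * hpr + L * d * u * L * K * hrr
         - b * v ^ 2 * c * u * L * K * hp
         - (b ^ 2 * u * v ^ 3 * L * K + b ^ 2 * u * v ^ 3 * c * u * L
            + b ^ 2 * v ^ 4 * e * u * L) * h8
    rw [hX2, hL, hK]
    linear_combination (b ^ 2 * u * v ^ 3 * (c * a * u ^ 2 + e * d * v ^ 2 + 
      2 * c * d * u * v - c * d * u * v)) * h8
  -- reduction modulo 2 of the remaining factors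
  have e2 : u ^ 3 * v * L ^ 2 * (s * K) *
      (2 * b * (u ^ 3 * v * L ^ 2 * (u * L * K)) * (u ^ 3 * v * L ^ 2 * (v * L * K)) +
        c * (u ^ 3 * v * L ^ 2 * (u * L * K)) * (u ^ 3 * v * L ^ 2 * (L * t)) +
        d * (u ^ 3 * v * L ^ 2 * (u * L * K)) * (u ^ 3 * v * L ^ 2 * (s * K)) +
        2 * e * (u ^ 3 * v * L ^ 2 * (v * L * K)) * (u ^ 3 * v * L ^ 2 * (L * t))) =
      4 * ((a * e + c * d) * b ^ 2 * (u ^ 11 * v ^ 7 * (L * K ^ 2 * L ^ 2 * (L ^ 2) ^ 2))) := by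
    linear_combination (u ^ 9 * v ^ 3 * L ^ 7 * K ^ 2) * e1
  rw [e2]
  let I : Ideal B := Ideal.span {2}
  let φ := Ideal.Quotient.mk I
  have h2 : (2 : B ⧸ I) = 0 := by
    have : φ 2 = 0 := Ideal.Quotient.eq_zero_iff_mem.2 (Ideal.subset_span rfl)
    rwa [map_ofNat] at this
  have four : ∀ x y : B, φ x = φ y → 4 * x = 4 * y := by
    intro x y h
    obtain ⟨z, hz⟩ := Ideal.mem_span_singleton'.1 (Ideal.Quotient.eq.1 h)
    linear_combination -4 * hz + z * h8
  have hφu : φ u = φ M := by rw [hu, map_add, map_mul, map_ofNat, h2]; ring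
  have hφv : φ v = φ N := by rw [hv, map_add, map_mul, map_ofNat, h2]; ring
  have hφL : φ L = φ a * φ M + φ d * φ N := by rw [hL, map_add, map_mul, map_mul, hφu, hφv]
  have hφK : φ K = φ c * φ M + φ e * φ N := by rw [hK, map_add, map_mul, map_mul, hφu, hφv]
  have sqadd : ∀ x y : B ⧸ I, (x + y) ^ 2 = x ^ 2 + y ^ 2 := by
    intro x y
    linear_combination x * y * h2
  have fin := four ((a * e + c * d) * b ^ 2 * (u ^ 11 * v ^ 7 * (L * K ^ 2 * L ^ 2 * (L ^ 2) ^ 2)))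
    ((a * e + c * d) * b ^ 2 * (M ^ 11 * N ^ 7 * ((a * M + d * N) *
        (c ^ 2 * M ^ 2 + e ^ 2 * N ^ 2) * (a ^ 2 * M ^ 2 + d ^ 2 * N ^ 2) *
        (a ^ 4 * M ^ 4 + d ^ 4 * N ^ 4)))) (by
      simp only [map_mul, map_add, map_pow, hφu, hφv, hφL, hφK, sqadd]
      ring)
  rw [fin]
  ring

lemma map_Gmap_three {B B' : Type} [CommRing B] [CommRing B'] (φ : B →+* B')
    (a b c d e u v p r : B) :
    φ (Gmap ![a, b, c, d, e] ![u, v, p, r] 3) =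
      Gmap ![φ a, φ b, φ c, φ d, φ e] ![φ u, φ v, φ p, φ r] 3 := by
  rw [Gmap_three a b c d e u v p r _ _ _ _ _ _ _ _ rfl rfl rfl rfl rfl rfl rfl rfl,
    Gmap_three (φ a) (φ b) (φ c) (φ d) (φ e) (φ u) (φ v) (φ p) (φ r)
      _ _ _ _ _ _ _ _ rfl rfl rfl rfl rfl rfl rfl rfl]
  simp only [cubv, map_mul, map_add, map_sub, map_pow, map_ofNat]

theorem stmt_8
    (w : S₈) (hw : w = X 0 * X 4 + X 2 * X 3)
    (q : Fin 4 → S₈)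
    (hq : q = Gmap ![X 0, X 1, X 2, X 3, X 4]
                   ![X 5 + 2 * X 7, X 6 + 2 * X 8, X 9, X 10]) :
    q 3 -
      4 * w * X 1 ^ 2 * X 5 ^ 11 * X 6 ^ 7 * (X 0 * X 5 + X 3 * X 6) *
        (X 2 ^ 2 * X 5 ^ 2 + X 4 ^ 2 * X 6 ^ 2) *
        (X 0 ^ 2 * X 5 ^ 2 + X 3 ^ 2 * X 6 ^ 2) *
        (X 0 ^ 4 * X 5 ^ 4 + X 3 ^ 4 * X 6 ^ 4)
      ∈ Ideal.span ({(8 : S₈), 2 * X 9, 2 * X 10, X 9 ^ 2, X 9 * X 10, X 10 ^ 2} : Set S₈) := by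
  subst hw hq
  rw [← Ideal.Quotient.eq_zero_iff_mem]
  set I := Ideal.span ({(8 : S₈), 2 * X 9, 2 * X 10, X 9 ^ 2, X 9 * X 10, X 10 ^ 2} : Set S₈)
    with hI
  let φ := Ideal.Quotient.mk I
  change φ _ = 0
  have hz : ∀ x ∈ ({(8 : S₈), 2 * X 9, 2 * X 10, X 9 ^ 2, X 9 * X 10, X 10 ^ 2} : Set S₈),
      φ x = 0 := fun x hx => Ideal.Quotient.eq_zero_iff_mem.2 (Ideal.subset_span hx)
  have h8 := hz 8 (by simp)
  have hp := hz (2 * X 9) (by simp)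
  have hr := hz (2 * X 10) (by simp)
  have hpr := hz (X 9 * X 10) (by simp)
  have hrr := hz (X 10 ^ 2) (by simp)
  rw [map_ofNat] at h8
  rw [map_mul, map_ofNat] at hp hr
  rw [map_mul] at hpr
  rw [map_pow] at hrr
  have h := Gmap_three_cong (φ (X 0)) (φ (X 1)) (φ (X 2)) (φ (X 3)) (φ (X 4)) (φ (X 5)) (φ (X 6))
    (φ (X 7)) (φ (X 8)) (φ (X 9)) (φ (X 10)) h8 hp hr hpr hrr
  rw [map_sub, map_Gmap_three, sub_eq_zero]
  simp only [map_mul, map_add, map_pow, map_ofNat]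
  exact h
end
end

section
/- Let R0 = ℤ[a2001, a1200, a1110, a1101, a0210], w = a2001·a0210 + a1110·a1101, and let (q0, q1, q2, q3) = G(X, Y, 0, 0) ∈ R0[X,Y]⁴, where X, Y are two further variables. Then the following congruences hold in R0[X,Y] modulo the ideal generated by 8: q2 ≡ 4·w·a1200²·X¹²·Y⁶·(a1110·X + a0210·Y)·(a2001⁸·X⁸ + a1101⁸·Y⁸) (mod 8), and q3 ≡ 4·w·a1200²·X¹¹·Y⁷·(a2001·X + a1101·Y)·(a1110²·X² + a0210²·Y²)·(a2001²·X² + a1101²·Y²)·(a2001⁴·X⁴ + a1101⁴·Y⁴) (mod 8). -/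
/- STATEMENT 10: the specializations at (X, Y, 0, 0) of the identities (eq_q2_in_I)
and (eq_q3_in_I), used in the proof of Corollary 3.10 of the paper, as congruences
modulo 8 in R0[X,Y].  R0 = MvPolynomial (Fin 5) ℤ (variables a2001,…,a0210 indexed
0,…,4), R0[X,Y] = MvPolynomial (Fin 2) R0 with X = X 0 and Y = X 1.  The cubic f,
the tuples σ1, σ2, σ3 and the composite substitution G = σ1 ∘ σ2 ∘ σ3 are defined
below. -/

open MvPolynomial

noncomputable section

variable {A : Type} [CommRing A]

abbrev R₀ : Type := MvPolynomial (Fin 5) ℤ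
abbrev RXY : Type := MvPolynomial (Fin 2) R₀

/-- The coefficients a2001, …, a0210 of R0, viewed in R0[X,Y]. -/
noncomputable def aC : Fin 5 → RXY := fun i => C (X i)

/-- Partial derivatives of the cubic. -/
theorem eval_d1 (a : Fin 5 → A) (v : Fin 4 → A) : eval v (pderiv 1 (cub a)) =
    2 * a 1 * v 0 * v 1 + a 2 * v 0 * v 2 + a 3 * v 0 * v 3 + 2 * a 4 * v 1 * v 2 := by
  simp [cub, pderiv_X, Pi.single_apply]
  ring

theorem eval_d2 (a : Fin 5 → A) (v : Fin 4 → A) : eval v (pderiv 2 (cub a)) =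
    v 1 * (a 2 * v 0 + a 4 * v 1) := by
  simp [cub, pderiv_X, Pi.single_apply]
  ring

theorem eval_d3 (a : Fin 5 → A) (v : Fin 4 → A) : eval v (pderiv 3 (cub a)) =
    v 0 * (a 0 * v 0 + a 3 * v 1) := by
  simp [cub, pderiv_X, Pi.single_apply]
  ring

theorem eval_cub (a : Fin 5 → A) (v : Fin 4 → A) : eval v (cub a) =
    a 0 * v 0 ^ 2 * v 3 + a 1 * v 0 * v 1 ^ 2 + a 2 * v 0 * v 1 * v 2 +
    a 3 * v 0 * v 1 * v 3 + a 4 * v 1 ^ 2 * v 2 := by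
  simp [cub]

theorem G_two (a : Fin 5 → A) (x y p m : A) (hp : p = a 0 * x + a 3 * y)
    (hm : m = a 2 * x + a 4 * y) : Gmap a ![x, y, 0, 0] 2 =
    4 * a 1 ^ 2 * x ^ 11 * y ^ 5 * p ^ 8 * m *
      (x * y * (a 0 * a 4 + a 2 * a 3) + 2 * (a 0 * a 4 * x * y - a 2 * a 3 * x * y
        + a 3 * a 4 * y ^ 2 + a 2 * x * p)) := by
  simp [Gmap, sig1, sig2, sig3, eval_d1, eval_d2, eval_d3, eval_cub]
  subst hp hm
  ring

theorem G_three (a : Fin 5 → A) (x y p m : A) (hp : p = a 0 * x + a 3 * y)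
    (hm : m = a 2 * x + a 4 * y) : Gmap a ![x, y, 0, 0] 3 =
    -4 * a 1 ^ 2 * x ^ 10 * y ^ 6 * p ^ 7 * m ^ 2 *
      (x * y * (a 0 * a 4 + a 2 * a 3) + 2 * (a 0 * a 4 * x * y - a 2 * a 3 * x * y
        + a 3 * a 4 * y ^ 2 + a 2 * x * p)) := by
  simp [Gmap, sig1, sig2, sig3, eval_d1, eval_d2, eval_d3, eval_cub]
  subst hp hm
  ring

theorem sq_two (u v : A) : ∃ t, (u + v) ^ 2 = u ^ 2 + v ^ 2 + 2 * t := ⟨u * v, by ring⟩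

theorem four_two (u v : A) : ∃ t, (u + v) ^ 4 = u ^ 4 + v ^ 4 + 2 * t :=
  ⟨2 * u ^ 3 * v + 3 * u ^ 2 * v ^ 2 + 2 * u * v ^ 3, by ring⟩

theorem eight_two (u v : A) : ∃ t, (u + v) ^ 8 = u ^ 8 + v ^ 8 + 2 * t :=
  ⟨4 * u ^ 7 * v + 14 * u ^ 6 * v ^ 2 + 28 * u ^ 5 * v ^ 3 + 35 * u ^ 4 * v ^ 4
    + 28 * u ^ 3 * v ^ 5 + 14 * u ^ 2 * v ^ 6 + 4 * u * v ^ 7, by ring⟩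

theorem main_two (a : Fin 5 → A) (x y : A) : (8 : A) ∣ Gmap a ![x, y, 0, 0] 2 -
      4 * (a 0 * a 4 + a 2 * a 3) * a 1 ^ 2 * x ^ 12 * y ^ 6 * (a 2 * x + a 4 * y) *
        (a 0 ^ 8 * x ^ 8 + a 3 ^ 8 * y ^ 8) := by
  rw [G_two a x y _ _ rfl rfl]
  obtain ⟨t, ht⟩ := eight_two (a 0 * x) (a 3 * y)
  have h : a 0 ^ 8 * x ^ 8 + a 3 ^ 8 * y ^ 8 = (a 0 * x + a 3 * y) ^ 8 - 2 * t := by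
    rw [ht]; ring
  rw [h]
  generalize a 0 * x + a 3 * y = p
  generalize a 2 * x + a 4 * y = m
  refine ⟨a 1 ^ 2 * x ^ 11 * y ^ 5 * p ^ 8 * m * (a 0 * a 4 * x * y - a 2 * a 3 * x * y
        + a 3 * a 4 * y ^ 2 + a 2 * x * p) +
      (a 0 * a 4 + a 2 * a 3) * a 1 ^ 2 * x ^ 12 * y ^ 6 * m * t, ?_⟩
  ring

theorem main_three (a : Fin 5 → A) (x y : A) : (8 : A) ∣ Gmap a ![x, y, 0, 0] 3 -
      4 * (a 0 * a 4 + a 2 * a 3) * a 1 ^ 2 * x ^ 11 * y ^ 7 * (a 0 * x + a 3 * y) *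
        (a 2 ^ 2 * x ^ 2 + a 4 ^ 2 * y ^ 2) * (a 0 ^ 2 * x ^ 2 + a 3 ^ 2 * y ^ 2) *
        (a 0 ^ 4 * x ^ 4 + a 3 ^ 4 * y ^ 4) := by
  rw [G_three a x y _ _ rfl rfl]
  obtain ⟨t, ht⟩ := four_two (a 0 * x) (a 3 * y)
  obtain ⟨s, hs⟩ := sq_two (a 0 * x) (a 3 * y)
  obtain ⟨r, hr⟩ := sq_two (a 2 * x) (a 4 * y)
  have h1 : a 0 ^ 4 * x ^ 4 + a 3 ^ 4 * y ^ 4 = (a 0 * x + a 3 * y) ^ 4 - 2 * t := by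
    rw [ht]; ring
  have h2 : a 0 ^ 2 * x ^ 2 + a 3 ^ 2 * y ^ 2 = (a 0 * x + a 3 * y) ^ 2 - 2 * s := by
    rw [hs]; ring
  have h3 : a 2 ^ 2 * x ^ 2 + a 4 ^ 2 * y ^ 2 = (a 2 * x + a 4 * y) ^ 2 - 2 * r := by
    rw [hr]; ring
  rw [h1, h2, h3]
  generalize a 0 * x + a 3 * y = p
  generalize a 2 * x + a 4 * y = m
  refine ⟨-(a 1 ^ 2 * x ^ 10 * y ^ 6 * p ^ 7 * m ^ 2 * (a 0 * a 4 * x * y - a 2 * a 3 * x * y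
        + a 3 * a 4 * y ^ 2 + a 2 * x * p)) -
      (a 0 * a 4 + a 2 * a 3) * a 1 ^ 2 * x ^ 11 * y ^ 7 * p *
        (p ^ 6 * m ^ 2 - r * (p ^ 2 - 2 * s) * (p ^ 4 - 2 * t)
          - m ^ 2 * s * (p ^ 4 - 2 * t) - m ^ 2 * p ^ 2 * t), ?_⟩
  ring

theorem stmt_10
    (w : R₀) (hw : w = X 0 * X 4 + X 2 * X 3)
    (q : Fin 4 → RXY)
    (hq : q = Gmap aC ![X 0, X 1, 0, 0]) :
    ((8 : RXY) ∣ (q 2 -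
      4 * C w * C (X 1) ^ 2 * X 0 ^ 12 * X 1 ^ 6 *
        (C (X 2) * X 0 + C (X 4) * X 1) *
        (C (X 0) ^ 8 * X 0 ^ 8 + C (X 3) ^ 8 * X 1 ^ 8))) ∧
    ((8 : RXY) ∣ (q 3 -
      4 * C w * C (X 1) ^ 2 * X 0 ^ 11 * X 1 ^ 7 *
        (C (X 0) * X 0 + C (X 3) * X 1) *
        (C (X 2) ^ 2 * X 0 ^ 2 + C (X 4) ^ 2 * X 1 ^ 2) *
        (C (X 0) ^ 2 * X 0 ^ 2 + C (X 3) ^ 2 * X 1 ^ 2) *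
        (C (X 0) ^ 4 * X 0 ^ 4 + C (X 3) ^ 4 * X 1 ^ 4))) := by
  subst hw hq
  have h2 := main_two aC (X 0) (X 1)
  have h3 := main_three aC (X 0) (X 1)
  simp only [aC] at h2 h3
  rw [map_add, map_mul, map_mul]
  exact ⟨h2, h3⟩
end
end
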